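/- arXiv:1508.02727 — 2 statements merged into one kernel-verified Lean document; each statement's English description precedes it below -/
import Mathlib

section
/- Let m₁, m₂ be positive real numbers and let r : (0,∞) → ℝ be a continuous function such that for every ρ > 0 one has 0 < r(ρ) < 1 and (1 − r(ρ))^{m₁} = ρ² · r(ρ)^{m₂}. Then the improper integral ∫₀^∞ 2·m₁·m₂·r(ρ)·(1 − r(ρ)) / [ (m₂² + (m₁² − m₂²)·r(ρ))² · (m₂ + (m₁ − m₂)·r(ρ)) · ρ ] dρ converges and equals 1/(m₁·m₂). -/
open Real Set MeasureTheory

/-- The inverse of the radial coordinate, `t ↦ (1 - t)^{m₁/2} t^{-m₂/2}`, written through `log`. -/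
noncomputable def radius (m₁ m₂ t : ℝ) : ℝ :=
  exp ((m₁ * log (1 - t) - m₂ * log t) / 2)

lemma radius_pos (m₁ m₂ t : ℝ) : 0 < radius m₁ m₂ t := exp_pos _

lemma strictAntiOn_radius {m₁ m₂ : ℝ} (hm₁ : 0 < m₁) (hm₂ : 0 < m₂) :
    StrictAntiOn (radius m₁ m₂) (Ioo 0 1) := by
  intro s hs t ht hst
  have h₁ := mul_lt_mul_of_pos_left
    (log_lt_log (by linarith [ht.2]) (by linarith : 1 - t < 1 - s)) hm₁
  have h₂ := mul_lt_mul_of_pos_left (log_lt_log hs.1 hst) hm₂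
  exact exp_lt_exp.2 (by linarith)

lemma hasDerivAt_radius (m₁ m₂ : ℝ) {t : ℝ} (ht : t ∈ Ioo (0 : ℝ) 1) :
    HasDerivAt (radius m₁ m₂)
      (-(radius m₁ m₂ t * (m₂ + (m₁ - m₂) * t) / (2 * t * (1 - t)))) t := by
  have h0 : t ≠ 0 := ht.1.ne'
  have h1 : 1 - t ≠ 0 := (sub_pos.2 ht.2).ne'
  have h := (((((hasDerivAt_id t).const_sub 1).log h1).const_mul m₁).sub
    ((hasDerivAt_log h0).const_mul m₂)).div_const 2 |>.exp
  refine HasDerivAt.congr_deriv (f := radius m₁ m₂) h ?_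
  simp only [radius, id, Pi.sub_apply]
  field_simp
  ring

lemma radius_eq_of_rpow_eq {m₁ m₂ t ρ : ℝ} (ht : t ∈ Ioo (0 : ℝ) 1) (hρ : 0 < ρ)
    (h : (1 - t) ^ m₁ = ρ ^ 2 * t ^ m₂) : radius m₁ m₂ t = ρ := by
  have hl := congrArg log h
  rw [log_rpow (sub_pos.2 ht.2), log_mul (by positivity) (rpow_pos_of_pos ht.1 _).ne',
    log_rpow ht.1, log_pow] at hl
  push_cast at hl
  rw [radius, hl, add_sub_cancel_right, mul_div_cancel_left₀ _ two_ne_zero, exp_log hρ]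

lemma affine_pos {a b t : ℝ} (ha : 0 < a) (hb : 0 < b) (ht : t ∈ Icc (0 : ℝ) 1) :
    0 < a + (b - a) * t := by
  nlinarith [mul_nonneg ht.1 hb.le, mul_nonneg (sub_nonneg.2 ht.2) ha.le, ht.1, ht.2,
    mul_nonneg ht.1 ht.1, mul_nonneg (sub_nonneg.2 ht.2) (sub_nonneg.2 ht.2)]

lemma intervalIntegrable_inv_affine_sq {a b : ℝ} (ha : 0 < a) (hb : 0 < b) :
    IntervalIntegrable (fun t => 1 / (a + (b - a) * t) ^ 2) volume 0 1 := by
  refine ContinuousOn.intervalIntegrable_of_Icc zero_le_one ?_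
  exact continuousOn_const.div (by fun_prop) fun t ht => (pow_pos (affine_pos ha hb ht) 2).ne'

lemma integral_inv_affine_sq {a b : ℝ} (ha : 0 < a) (hb : 0 < b) :
    ∫ t in (0 : ℝ)..1, 1 / (a + (b - a) * t) ^ 2 = 1 / (a * b) := by
  have hderiv : ∀ t ∈ uIcc (0 : ℝ) 1,
      HasDerivAt (fun t => t / (a * (a + (b - a) * t))) (1 / (a + (b - a) * t) ^ 2) t := by
    intro t ht
    rw [uIcc_of_le zero_le_one] at ht
    have hpos := affine_pos ha hb ht
    have h := (hasDerivAt_id t).div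
      ((((hasDerivAt_id t).const_mul (b - a)).const_add a).const_mul a)
      (mul_pos ha hpos).ne'
    refine HasDerivAt.congr_deriv
      (f := fun t => t / (a * (a + (b - a) * t))) h ?_
    simp only [id]
    field_simp
    ring
  rw [intervalIntegral.integral_eq_sub_of_hasDerivAt hderiv
    (intervalIntegrable_inv_affine_sq ha hb)]
  simp

/-- The curvature integral in radial coordinates: if `r : (0,∞) → (0,1)` is the
(continuous) inverse of `t ↦ (1−t)^{m₁/2}·t^{−m₂/2}`, i.e. satisfies
`(1 − r(ρ))^{m₁} = ρ²·r(ρ)^{m₂}`, then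
`∫₀^∞ 2m₁m₂ r(ρ)(1−r(ρ)) / [(m₂²+(m₁²−m₂²)r(ρ))²(m₂+(m₁−m₂)r(ρ)) ρ] dρ`
converges and equals `1/(m₁·m₂)`. -/
theorem chern_number_integral_radial
    (m₁ m₂ : ℝ) (hm₁ : 0 < m₁) (hm₂ : 0 < m₂)
    (r : ℝ → ℝ) (hcont : ContinuousOn r (Ioi (0:ℝ)))
    (hr0 : ∀ ρ : ℝ, 0 < ρ → 0 < r ρ)
    (hr1 : ∀ ρ : ℝ, 0 < ρ → r ρ < 1)
    (heq : ∀ ρ : ℝ, 0 < ρ → (1 - r ρ) ^ m₁ = ρ ^ 2 * (r ρ) ^ m₂) :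
    IntegrableOn
      (fun ρ : ℝ => 2 * m₁ * m₂ * r ρ * (1 - r ρ) /
        ((m₂ ^ 2 + (m₁ ^ 2 - m₂ ^ 2) * r ρ) ^ 2
          * (m₂ + (m₁ - m₂) * r ρ) * ρ)) (Ioi (0:ℝ)) ∧
    ∫ ρ in Ioi (0:ℝ), 2 * m₁ * m₂ * r ρ * (1 - r ρ) /
        ((m₂ ^ 2 + (m₁ ^ 2 - m₂ ^ 2) * r ρ) ^ 2
          * (m₂ + (m₁ - m₂) * r ρ) * ρ)
      = 1 / (m₁ * m₂) := by
  set f : ℝ → ℝ := fun ρ => 2 * m₁ * m₂ * r ρ * (1 - r ρ) /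
    ((m₂ ^ 2 + (m₁ ^ 2 - m₂ ^ 2) * r ρ) ^ 2 * (m₂ + (m₁ - m₂) * r ρ) * ρ) with hf
  have hmem : ∀ ρ, 0 < ρ → r ρ ∈ Ioo (0 : ℝ) 1 := fun ρ hρ => ⟨hr0 ρ hρ, hr1 ρ hρ⟩
  have hanti := strictAntiOn_radius hm₁ hm₂
  have hradius : ∀ ρ, 0 < ρ → radius m₁ m₂ (r ρ) = ρ := fun ρ hρ =>
    radius_eq_of_rpow_eq (hmem ρ hρ) hρ (heq ρ hρ)
  have himage : radius m₁ m₂ '' Ioo 0 1 = Ioi 0 := by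
    refine Subset.antisymm (image_subset_iff.2 fun t _ => radius_pos m₁ m₂ t) ?_
    exact fun ρ hρ => ⟨r ρ, hmem ρ hρ, hradius ρ hρ⟩
  have hinv : ∀ t ∈ Ioo (0 : ℝ) 1, r (radius m₁ m₂ t) = t := fun t ht =>
    hanti.injOn (hmem _ (radius_pos m₁ m₂ t)) ht (hradius _ (radius_pos m₁ m₂ t))
  have hderiv : ∀ t ∈ Ioo (0 : ℝ) 1, HasDerivWithinAt (radius m₁ m₂)
      (-(radius m₁ m₂ t * (m₂ + (m₁ - m₂) * t) / (2 * t * (1 - t)))) (Ioo 0 1) t :=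
    fun t ht => (hasDerivAt_radius m₁ m₂ ht).hasDerivWithinAt
  have hcongr : EqOn (fun t => (- -(radius m₁ m₂ t * (m₂ + (m₁ - m₂) * t) / (2 * t * (1 - t)))) •
      f (radius m₁ m₂ t))
      (fun t => m₁ * m₂ * (1 / (m₂ ^ 2 + (m₁ ^ 2 - m₂ ^ 2) * t) ^ 2)) (Ioo 0 1) := by
    intro t ht
    have h0 : t ≠ 0 := ht.1.ne'
    have h1 : 1 - t ≠ 0 := (sub_pos.2 ht.2).ne'
    have hρ := (radius_pos m₁ m₂ t).ne'
    have hE := (affine_pos hm₂ hm₁ (Ioo_subset_Icc_self ht)).ne'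
    have hD := (affine_pos (pow_pos hm₂ 2) (pow_pos hm₁ 2) (Ioo_subset_Icc_self ht)).ne'
    simp only [hf, hinv t ht, smul_eq_mul, neg_neg]
    generalize m₂ + (m₁ - m₂) * t = E at *
    generalize m₂ ^ 2 + (m₁ ^ 2 - m₂ ^ 2) * t = D at *
    field_simp
  rw [← himage, integrableOn_image_iff_integrableOn_deriv_smul_of_antitoneOn measurableSet_Ioo
      hderiv hanti.antitoneOn, integral_image_eq_integral_deriv_smul_of_antitoneOn
      measurableSet_Ioo hderiv hanti.antitoneOn, integrableOn_congr_fun hcongr measurableSet_Ioo,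
    setIntegral_congr_fun measurableSet_Ioo hcongr]
  constructor
  · exact ((intervalIntegrable_iff_integrableOn_Ioo_of_le zero_le_one).1
      (intervalIntegrable_inv_affine_sq (pow_pos hm₂ 2) (pow_pos hm₁ 2))).const_mul _
  · rw [← integral_Ioc_eq_integral_Ioo, ← intervalIntegral.integral_of_le zero_le_one,
      intervalIntegral.integral_const_mul,
      integral_inv_affine_sq (pow_pos hm₂ 2) (pow_pos hm₁ 2)]
    field_simp
end

section
/- Let m₁, m₂ be positive integers. On the open interval (0,1) define λ₁(t) := −√((m₁² − m₂²)·t + m₂²)/√(t·(1−t)), λ₂(t) := −((m₁ − m₂)·t + m₂)/√(t·(1−t)), γ(t) := (1−t)^{m₁}·t^{−m₂}, and F(t) := 2·λ₂(t)·λ₁′(t)·γ(t) / (λ₁(t)²·γ′(t)), where λ₁′ and γ′ denote derivatives. Then F(t) converges to a finite limit L₀ as t → 0⁺ (within (0,1)) and to a finite limit L₁ as t → 1⁻ (within (0,1)), and |L₁ − L₀| = 1/m₁ + 1/m₂. -/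
open Real Set Filter

/-- The derivative of `t ↦ (1 - t) ^ a * t ^ (-b)`, written through its logarithmic derivative. -/
lemma hasDerivAt_one_sub_rpow_mul_rpow_neg (a b : ℝ) {t : ℝ} (ht : t ∈ Ioo (0 : ℝ) 1) :
    HasDerivAt (fun t : ℝ => (1 - t) ^ a * t ^ (-b))
      (-((1 - t) ^ a * t ^ (-b) * (((a - b) * t + b) / (t * (1 - t))))) t := by
  have h0 : 0 < t := ht.1
  have h1 : 0 < 1 - t := sub_pos.2 ht.2
  have hl := ((hasDerivAt_id' t).const_sub 1).rpow_const (p := a) (Or.inl h1.ne')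
  have hr := (hasDerivAt_id' t).rpow_const (p := -b) (Or.inl h0.ne')
  refine (hl.mul hr).congr_deriv ?_
  rw [Real.rpow_sub_one h1.ne', Real.rpow_sub_one h0.ne']
  field_simp
  ring

/-- The derivative of `t ↦ -(√(c t + d) / √(t (1 - t)))`. -/
lemma hasDerivAt_neg_sqrt_div_sqrt (c d : ℝ) {t : ℝ} (ht : t ∈ Ioo (0 : ℝ) 1)
    (hp : 0 < c * t + d) :
    HasDerivAt (fun t : ℝ => -(√(c * t + d) / √(t * (1 - t))))
      (-((c / (2 * √(c * t + d)) * √(t * (1 - t))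
        - √(c * t + d) * ((1 - 2 * t) / (2 * √(t * (1 - t))))) / √(t * (1 - t)) ^ 2)) t := by
  have hq : 0 < t * (1 - t) := mul_pos ht.1 (sub_pos.2 ht.2)
  have hl : HasDerivAt (fun t : ℝ => c * t + d) c t := by
    simpa using ((hasDerivAt_id' t).const_mul c).add_const d
  have hr : HasDerivAt (fun t : ℝ => t * (1 - t)) (1 - 2 * t) t :=
    ((hasDerivAt_id' t).mul ((hasDerivAt_id' t).const_sub 1)).congr_deriv (by ring)
  exact ((hl.sqrt hp.ne').div (hr.sqrt hq.ne') (Real.sqrt_pos.2 hq).ne').neg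

/-- The Gauß–Bonnet computation of `χ(ℂP¹(m₁,m₂))`: the function
`F = 2·λ₂·λ₁′·γ/(λ₁²·γ′)` has finite one-sided limits `L₀` at `0⁺` and `L₁`
at `1⁻`, and `|L₁ − L₀| = 1/m₁ + 1/m₂`. -/
theorem euler_characteristic_weighted_projective_space
    (m₁ m₂ : ℕ) (hm₁ : 0 < m₁) (hm₂ : 0 < m₂) :
    let lam₁ : ℝ → ℝ := fun t =>
      -(Real.sqrt (((m₁ : ℝ) ^ 2 - (m₂ : ℝ) ^ 2) * t + (m₂ : ℝ) ^ 2)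
        / Real.sqrt (t * (1 - t)))
    let lam₂ : ℝ → ℝ := fun t =>
      -((((m₁ : ℝ) - (m₂ : ℝ)) * t + (m₂ : ℝ)) / Real.sqrt (t * (1 - t)))
    let gam : ℝ → ℝ := fun t => (1 - t) ^ (m₁ : ℝ) * t ^ (-(m₂ : ℝ))
    let F : ℝ → ℝ := fun t =>
      2 * lam₂ t * deriv lam₁ t * gam t / ((lam₁ t) ^ 2 * deriv gam t)
    ∃ L₀ L₁ : ℝ,
      Tendsto F (nhdsWithin 0 (Ioo (0:ℝ) 1)) (nhds L₀) ∧
      Tendsto F (nhdsWithin 1 (Ioo (0:ℝ) 1)) (nhds L₁) ∧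
      |L₁ - L₀| = 1 / (m₁ : ℝ) + 1 / (m₂ : ℝ) := by
  have ha : (0 : ℝ) < m₁ := Nat.cast_pos.2 hm₁
  have hb : (0 : ℝ) < m₂ := Nat.cast_pos.2 hm₂
  generalize (m₁ : ℝ) = a at ha ⊢
  generalize (m₂ : ℝ) = b at hb ⊢
  intro lam₁ lam₂ gam F
  let G : ℝ → ℝ := fun t =>
    ((1 - 2 * t) - (a ^ 2 - b ^ 2) * (t * (1 - t)) / ((a ^ 2 - b ^ 2) * t + b ^ 2))
      / √((a ^ 2 - b ^ 2) * t + b ^ 2)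
  have hFG : EqOn G F (Ioo 0 1) := by
    intro t ht
    have h0 : 0 < t := ht.1
    have h1 : 0 < 1 - t := sub_pos.2 ht.2
    have hq : 0 < t * (1 - t) := mul_pos h0 h1
    have hp : 0 < (a ^ 2 - b ^ 2) * t + b ^ 2 := by
      have : 0 < a ^ 2 * t + b ^ 2 * (1 - t) := by positivity
      linarith
    have hn : 0 < (a - b) * t + b := by
      have : 0 < a * t + b * (1 - t) := by positivity
      linarith
    have hg : 0 < (1 - t) ^ a * t ^ (-b) :=
      mul_pos (Real.rpow_pos_of_pos h1 _) (Real.rpow_pos_of_pos h0 _)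
    simp only [G, F]
    rw [(hasDerivAt_neg_sqrt_div_sqrt _ _ ht hp).deriv,
      (hasDerivAt_one_sub_rpow_mul_rpow_neg a b ht).deriv]
    simp only [lam₁, lam₂, gam]
    have hs := Real.sqrt_pos.2 hp
    have hr := Real.sqrt_pos.2 hq
    have hs2 := Real.sq_sqrt hp.le
    have hr2 := Real.sq_sqrt hq.le
    generalize (1 - t) ^ a * t ^ (-b) = g at *
    generalize √((a ^ 2 - b ^ 2) * t + b ^ 2) = s at *
    generalize √(t * (1 - t)) = r at *
    generalize (a - b) * t + b = n at *
    rw [← hs2, ← hr2]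
    field_simp
    ring
  have hG : ∀ x, 0 < (a ^ 2 - b ^ 2) * x + b ^ 2 →
      Tendsto F (nhdsWithin x (Ioo 0 1)) (nhds (G x)) := by
    intro x hx
    have hc : ContinuousAt G x := by
      have hs := (Real.sqrt_pos.2 hx).ne'
      have hx' := hx.ne'
      simp only [G]
      fun_prop (disch := assumption)
    exact (hc.tendsto.mono_left nhdsWithin_le_nhds).congr' hFG.eventuallyEq_nhdsWithin
  refine ⟨G 0, G 1, hG 0 (by simpa using pow_pos hb 2), hG 1 (by simpa using pow_pos ha 2), ?_⟩
  have hG0 : G 0 = 1 / b := by simp [G, Real.sqrt_sq hb.le]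
  have hG1 : G 1 = -(1 / a) := by
    norm_num [G, Real.sqrt_sq ha.le, neg_div]
  rw [hG0, hG1, abs_of_neg]
  · ring
  · have : 0 < 1 / a + 1 / b := by positivity
    linarith
end
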